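/- Let r ≥ 1 be an integer such that √(8r) is an integer, let τ and τ′ be orderings of a finite set N with Inv(τ, τ′) ≤ r, and let χ : N → [1, √(8r)] be a coloring obtained by assigning to each element of N an independent, uniformly random color. Then with probability at least (2e)^{−√(r/8)}, every color class Z^i := {v ∈ N : χ(v) = i} satisfies τ[Z^i] = τ′[Z^i], i.e., the elements of each color class appear in the same relative order on τ and on τ′. -/

import Mathlib

/-- Swap the two consecutive elements at (0-based) positions `i` and `i+1`. -/
def swapAdj {α : Type*} : ℕ → List α → List α
  | 0, a :: b :: l => b :: a :: l
  | n + 1, a :: l => a :: swapAdj n l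
  | _, l => l

/-- Apply a sequence of inversions (given as a list of 0-based positions) to a list. -/
def applySeq {α : Type*} (S : List ℕ) (l : List α) : List α :=
  S.foldl (fun acc i => swapAdj i acc) l

/-- A sequence of inversions is valid for length `n` if every position lies in `[0, n-2]`. -/
def validSeq (n : ℕ) (S : List ℕ) : Prop := ∀ i ∈ S, i + 1 < n

/-- The inversions (Kendall tau) distance. -/
noncomputable def InvDist {α : Type*} (τ τ' : List α) : ℕ :=
  sInf {r | ∃ S : List ℕ, validSeq τ.length S ∧ S.length = r ∧ applySeq S τ = τ'}

open Finset in
/-- The colorings of the vertices of `G` that are proper. -/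
noncomputable def properColorings {α : Type*} [Fintype α] [DecidableEq α] (G : SimpleGraph α)
    (c : ℕ) : Finset (α → Fin c) :=
  open Classical in univ.filter fun χ => ∀ u v, G.Adj u v → χ u ≠ χ v

theorem mem_properColorings {α : Type*} [Fintype α] [DecidableEq α] {G : SimpleGraph α}
    {c : ℕ} {χ : α → Fin c} :
    χ ∈ properColorings G c ↔ ∀ u v, G.Adj u v → χ u ≠ χ v := by
  simp [properColorings]

theorem applySeq_append {α : Type*} (S T : List ℕ) (l : List α) :
    applySeq (S ++ T) l = applySeq T (applySeq S l) := by
  simp [applySeq]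

theorem applySeq_map_succ {α : Type*} (S : List ℕ) (a : α) (l : List α) :
    applySeq (S.map (· + 1)) (a :: l) = a :: applySeq S l := by
  induction S generalizing l with
  | nil => rfl
  | cons i S ih => exact ih (swapAdj i l)

theorem exists_applySeq_eq_of_perm {α : Type*} {l l' : List α} (h : l.Perm l') :
    ∃ S, validSeq l.length S ∧ applySeq S l = l' := by
  induction h with
  | nil => exact ⟨[], by simp [validSeq], rfl⟩
  | @cons a l l' _ ih =>
    obtain ⟨S, hS, rfl⟩ := ih
    refine ⟨S.map (· + 1), ?_, applySeq_map_succ S a l⟩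
    intro i hi
    obtain ⟨j, hj, rfl⟩ := List.mem_map.1 hi
    simpa using hS j hj
  | swap a b l => exact ⟨[0], by simp [validSeq], rfl⟩
  | trans h₁ _ ih₁ ih₂ =>
    obtain ⟨S, hS, rfl⟩ := ih₁
    obtain ⟨T, hT, rfl⟩ := ih₂
    refine ⟨S ++ T, ?_, applySeq_append S T _⟩
    intro i hi
    rcases List.mem_append.1 hi with hi | hi
    · exact hS i hi
    · simpa [h₁.length_eq] using hT i hi

theorem exists_length_eq_InvDist {α : Type*} {τ τ' : List α} (h : τ.Perm τ') :
    ∃ S, S.length = InvDist τ τ' ∧ applySeq S τ = τ' := by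
  obtain ⟨S, hS, hSτ⟩ := exists_applySeq_eq_of_perm h
  obtain ⟨T, -, hT⟩ := Nat.sInf_mem (s := {r | ∃ S : List ℕ, validSeq τ.length S ∧
    S.length = r ∧ applySeq S τ = τ'}) ⟨_, S, hS, rfl, hSτ⟩
  exact ⟨T, hT⟩

/-- A single inversion affects only the relative order of one pair of elements. -/
theorem exists_pair_filter_swapAdj {α : Type*} (i : ℕ) (l : List α) :
    swapAdj i l = l ∨ ∃ a b, a ≠ b ∧ ∀ p : α → Bool, ¬(p a ∧ p b) →
      (swapAdj i l).filter p = l.filter p := by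
  induction l generalizing i with
  | nil => left; cases i <;> rfl
  | cons a l ih =>
    cases i with
    | zero =>
      cases l with
      | nil => left; rfl
      | cons b l =>
        by_cases hab : a = b
        · left; subst hab; rfl
        · refine .inr ⟨a, b, hab, fun p hp => ?_⟩
          cases ha : p a <;> cases hb : p b <;> simp_all [swapAdj]
    | succ i =>
      rcases ih i with h | ⟨x, y, hxy, h⟩
      · left; simp [swapAdj, h]
      · exact .inr ⟨x, y, hxy, fun p hp => by simp [swapAdj, List.filter_cons, h p hp]⟩

/-- A sequence of `k` inversions affects only the relative orders of at most `k` pairs of distinct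
elements. -/
theorem exists_pairs_filter_applySeq {α : Type*} [DecidableEq α] (S : List ℕ) (l : List α) :
    ∃ E : Finset (Sym2 α), E.card ≤ S.length ∧ ∀ p : α → Bool,
      (∀ a b, a ≠ b → s(a, b) ∈ E → ¬(p a ∧ p b)) → l.filter p = (applySeq S l).filter p := by
  induction S generalizing l with
  | nil => exact ⟨∅, by simp, fun p _ => rfl⟩
  | cons i S ih =>
    obtain ⟨E, hE, h⟩ := ih (swapAdj i l)
    rcases exists_pair_filter_swapAdj i l with hi | ⟨a, b, hab, hi⟩
    · refine ⟨E, by simp; omega, fun p hp => ?_⟩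
      have := h p hp
      rw [hi] at this
      rw [this, applySeq, applySeq, List.foldl_cons, hi]
    · refine ⟨insert s(a, b) E, (Finset.card_insert_le _ _).trans (by simpa using hE),
        fun p hp => ?_⟩
      rw [← hi p (hp a b hab (by simp))]
      exact h p fun x y hxy hxyE => hp x y hxy (by simp [hxyE])

/-- A graph with `m ≥ 1` edges has a non-isolated vertex of degree at most `√(2m)`. -/
theorem exists_degree_sq_le {α : Type*} [Fintype α] (G : SimpleGraph α) [DecidableRel G.Adj]
    (hG : 0 < G.edgeFinset.card) :
    ∃ v, 0 < G.degree v ∧ G.degree v ^ 2 ≤ 2 * G.edgeFinset.card := by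
  set s : Finset α := Finset.univ.filter fun v => 0 < G.degree v
  have hsum : ∑ v ∈ s, G.degree v = 2 * G.edgeFinset.card := by
    rw [← G.sum_degrees_eq_twice_card_edges]
    refine Finset.sum_subset (Finset.subset_univ _) fun v _ hv => ?_
    simpa [s] using hv
  have hs : s.Nonempty := by
    by_contra h
    rw [Finset.not_nonempty_iff_eq_empty.1 h] at hsum
    simp only [Finset.sum_empty] at hsum
    omega
  obtain ⟨v, hv, hmin⟩ := s.exists_min_image (G.degree ·) hs
  refine ⟨v, by simpa [s] using hv, ?_⟩
  have hle : G.degree v ≤ s.card := by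
    rw [← G.card_neighborFinset_eq_degree]
    refine Finset.card_le_card fun u hu => ?_
    simp only [s, Finset.mem_filter, Finset.mem_univ, true_and, G.degree_pos_iff_exists_adj]
    exact ⟨v, ((G.mem_neighborFinset v u).1 hu).symm⟩
  calc G.degree v ^ 2 ≤ s.card * G.degree v := by rw [sq]; gcongr
    _ ≤ ∑ v ∈ s, G.degree v := by simpa using s.card_nsmul_le_sum _ _ hmin
    _ = _ := hsum

/-- Reinstating the edges at a vertex `v` destroys at most a fraction `deg v / c` of the proper
colorings with `c` colors. -/
theorem card_properColorings_deleteIncidenceSet {α : Type*} [Fintype α] [DecidableEq α]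
    (G : SimpleGraph α) [DecidableRel G.Adj] (c : ℕ) (v : α) :
    c * (properColorings (G.deleteIncidenceSet v) c).card ≤
      c * (properColorings G c).card +
        G.degree v * (properColorings (G.deleteIncidenceSet v) c).card := by
  set A := properColorings (G.deleteIncidenceSet v) c with hA
  set B : α → Finset (α → Fin c) := fun u => A.filter fun χ => χ v = χ u
  have hcover : A ⊆ properColorings G c ∪ (G.neighborFinset v).biUnion B := by
    intro χ hχ
    by_cases h : ∃ u, G.Adj v u ∧ χ v = χ u
    · obtain ⟨u, hu, he⟩ := h
      refine Finset.mem_union_right _ (Finset.mem_biUnion.2 ⟨u, by simpa using hu, ?_⟩)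
      simp [B, hχ, he]
    · push Not at h
      refine Finset.mem_union_left _ (mem_properColorings.2 fun x y hxy => ?_)
      by_cases hx : x = v
      · subst hx; exact h y hxy
      by_cases hy : y = v
      · subst hy; exact (h x hxy.symm).symm
      exact mem_properColorings.1 hχ x y (by simp [SimpleGraph.deleteIncidenceSet_adj, *])
  have hB : ∀ u ∈ G.neighborFinset v, c * (B u).card ≤ A.card := by
    intro u hu
    have huv : u ≠ v := ((G.mem_neighborFinset v u).1 hu).ne'
    have : (B u ×ˢ (Finset.univ : Finset (Fin c))).card ≤ A.card := by
      refine Finset.card_le_card_of_injOn (fun q => Function.update q.1 v q.2) ?_ ?_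
      · rintro ⟨χ, i⟩ hq
        have hχ : χ ∈ A := by
          have := (Finset.mem_product.1 hq).1
          exact (Finset.mem_filter.1 this).1
        refine mem_properColorings.2 fun x y hxy => ?_
        have hxy' := SimpleGraph.deleteIncidenceSet_adj.1 hxy
        simpa [Function.update_of_ne hxy'.2.1, Function.update_of_ne hxy'.2.2] using
          mem_properColorings.1 hχ x y hxy
      · rintro ⟨χ, i⟩ hq ⟨ψ, j⟩ hq' he
        have hχ : χ v = χ u := (Finset.mem_filter.1 (Finset.mem_product.1 hq).1).2
        have hψ : ψ v = ψ u := (Finset.mem_filter.1 (Finset.mem_product.1 hq').1).2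
        have he' : ∀ w, Function.update χ v i w = Function.update ψ v j w := congrFun he
        have hne : ∀ w, w ≠ v → χ w = ψ w := fun w hw => by simpa [hw] using he' w
        have hij : i = j := by simpa using he' v
        refine Prod.ext (funext fun w => ?_) hij
        by_cases hw : w = v
        · subst hw
          simpa [hχ, hψ] using hne u huv
        · exact hne w hw
    simpa [mul_comm] using this
  calc c * A.card
      ≤ c * ((properColorings G c).card + ∑ u ∈ G.neighborFinset v, (B u).card) := by
        gcongr
        exact (Finset.card_le_card hcover).trans ((Finset.card_union_le _ _).trans
          (by gcongr; exact Finset.card_biUnion_le))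
    _ = c * (properColorings G c).card + ∑ u ∈ G.neighborFinset v, c * (B u).card := by
        rw [mul_add, Finset.mul_sum]
    _ ≤ _ := by
        gcongr
        simpa using Finset.sum_le_card_nsmul _ _ _ hB

theorem two_mul_exp_one_rpow_neg_le {x : ℝ} (h0 : 0 ≤ x) (h1 : x ≤ 1 / 2) :
    (2 * Real.exp 1) ^ (-x) ≤ 1 - x := by
  have he : (2 : ℝ) ≤ Real.exp 1 := by linarith [Real.add_one_le_exp (1 : ℝ)]
  calc (2 * Real.exp 1) ^ (-x) ≤ ((2 : ℝ) ^ (2 : ℝ)) ^ (-x) :=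
        Real.rpow_le_rpow_of_nonpos (by positivity) (by norm_num; linarith) (by linarith)
    _ = (1 + -(1 / 2) : ℝ) ^ (2 * x) := by
        rw [← Real.rpow_mul (by norm_num), mul_neg, Real.rpow_neg (by norm_num),
          ← Real.inv_rpow (by norm_num)]
        norm_num
    _ ≤ 1 + 2 * x * -(1 / 2) :=
        rpow_one_add_le_one_add_mul_self (by norm_num) (by linarith) (by linarith)
    _ = 1 - x := by ring

/-- A graph with `m` edges is properly colored by a uniformly random coloring with `c ≥ √(8m)`
colors with probability at least `(2e)^(-m/c)`. -/
theorem le_card_properColorings {α : Type*} [Fintype α] [DecidableEq α] (G : SimpleGraph α)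
    [DecidableRel G.Adj] (c : ℕ) (hc : 0 < c) (hG : 8 * G.edgeFinset.card ≤ c ^ 2) :
    (2 * Real.exp 1) ^ (-((G.edgeFinset.card : ℝ) / c)) * (c : ℝ) ^ Fintype.card α ≤
      (properColorings G c).card := by
  induction hm : G.edgeFinset.card using Nat.strong_induction_on generalizing G with
  | _ m ih =>
    have hc' : (0 : ℝ) < c := by exact_mod_cast hc
    rcases Nat.eq_zero_or_pos m with rfl | hpos
    · have hbot : G = ⊥ := by
        simpa using hm
      have : properColorings G c = Finset.univ := by
        ext χ; simp [mem_properColorings, hbot]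
      simp [this]
    · obtain ⟨v, hv, hsq⟩ := exists_degree_sq_le G (hm ▸ hpos)
      have hdeg : G.degree v ≤ m := hm ▸ G.degree_le_card_edgeFinset v
      have hcard := hm ▸ G.card_edgeFinset_deleteIncidenceSet v
      have hrec := ih (m - G.degree v) (by omega) (G.deleteIncidenceSet v)
        (by omega) hcard
      have hstep : (c : ℝ) * (properColorings (G.deleteIncidenceSet v) c).card ≤
          c * (properColorings G c).card +
            G.degree v * (properColorings (G.deleteIncidenceSet v) c).card := by
        exact_mod_cast card_properColorings_deleteIncidenceSet G c v
      have hhalf : (G.degree v : ℝ) / c ≤ 1 / 2 := by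
        have : 2 * G.degree v ≤ c := by nlinarith
        rw [div_le_iff₀ hc']
        have : (2 : ℝ) * G.degree v ≤ c := by exact_mod_cast this
        linarith
      have hexp : -((m : ℝ) / c) =
          -((G.degree v : ℝ) / c) + -(((m - G.degree v : ℕ) : ℝ) / c) := by
        rw [Nat.cast_sub hdeg]; ring
      rw [hexp, Real.rpow_add (by positivity), mul_assoc]
      calc _ ≤ (1 - (G.degree v : ℝ) / c) *
            (properColorings (G.deleteIncidenceSet v) c).card :=
            mul_le_mul (two_mul_exp_one_rpow_neg_le (by positivity) hhalf) hrec
              (by positivity) (by linarith)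
        _ ≤ (properColorings G c).card := by
            have : (1 - (G.degree v : ℝ) / c) *
                (properColorings (G.deleteIncidenceSet v) c).card =
                (c * (properColorings (G.deleteIncidenceSet v) c).card -
                  G.degree v * (properColorings (G.deleteIncidenceSet v) c).card) / c := by
              field_simp
            rw [this, div_le_iff₀ hc']
            linarith

/-- Let `r ≥ 1` with `√(8r)` an integer `c`, and let `τ, τ'` be orderings
of the finite set `α` with `Inv(τ, τ') ≤ r`. Assigning to each element an independent
uniformly random color from `c` colors, with probability at least `(2e)^(−√(r/8))`
every color class appears in the same relative order on `τ` and `τ'`. Probability is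
expressed by counting colorings: the number of good colorings is at least
`(2e)^(−√(r/8)) · c^{|N|}`. -/
theorem stmt7 {α : Type*} [Fintype α] [DecidableEq α]
    (r : ℕ) (hr : 1 ≤ r) (c : ℕ) (hc : (c : ℝ) = Real.sqrt (8 * r))
    (τ τ' : List α) (h1 : τ.Nodup) (h2 : τ'.Nodup) (hp : τ.Perm τ')
    (hall : ∀ x, x ∈ τ) (hinv : InvDist τ τ' ≤ r) :
    (2 * Real.exp 1) ^ (-Real.sqrt ((r : ℝ) / 8)) * (c : ℝ) ^ (Fintype.card α)
      ≤ ((Finset.univ.filter (fun χ : α → Fin c =>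
            ∀ i : Fin c, τ.filter (fun v => decide (χ v = i))
              = τ'.filter (fun v => decide (χ v = i)))).card : ℝ) := by
  classical
  have hr' : (1 : ℝ) ≤ r := by exact_mod_cast hr
  have hc2 : (c : ℝ) ^ 2 = 8 * r := by rw [hc, Real.sq_sqrt (by positivity)]
  have hcpos : (0 : ℝ) < c := by rw [hc]; positivity
  have hratio : Real.sqrt ((r : ℝ) / 8) = r / c := by
    rw [Real.sqrt_eq_iff_mul_self_eq (by positivity) (by positivity), div_mul_div_comm, ← sq, ← sq,
      hc2]
    field_simp
  obtain ⟨S, hS, rfl⟩ := exists_length_eq_InvDist hp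
  obtain ⟨E, hE, hfilter⟩ := exists_pairs_filter_applySeq S τ
  obtain ⟨G, hGE⟩ : ∃ G : SimpleGraph α, G = SimpleGraph.fromEdgeSet E := ⟨_, rfl⟩
  have hG : G.edgeFinset.card ≤ r := by
    refine (Finset.card_le_card fun e he => ?_).trans (hE.trans (hS.trans_le hinv))
    have := SimpleGraph.mem_edgeFinset.1 he
    rw [hGE, SimpleGraph.edgeSet_fromEdgeSet] at this
    exact this.1
  have hc2' : c ^ 2 = 8 * r := by exact_mod_cast hc2
  have he : (1 : ℝ) ≤ 2 * Real.exp 1 := by linarith [Real.add_one_le_exp (1 : ℝ)]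
  calc _ ≤ (2 * Real.exp 1) ^ (-((G.edgeFinset.card : ℝ) / c)) * (c : ℝ) ^ Fintype.card α := by
        rw [hratio]
        gcongr
    _ ≤ (properColorings G c).card :=
        le_card_properColorings G c (by exact_mod_cast hcpos) (by omega)
    _ ≤ _ := by
        refine Nat.cast_le.2 (Finset.card_le_card fun χ hχ => ?_)
        refine Finset.mem_filter.2 ⟨Finset.mem_univ _, fun i => hfilter _ fun a b hab hE h => ?_⟩
        refine mem_properColorings.1 hχ a b (by simp [hGE, hab, hE]) ?_
        simp only [decide_eq_true_eq] at h
        rw [h.1, h.2]
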